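/- Let H ⊆ Y^n be finite with DS dimension at most d (i.e., no sequence of d+1 coordinates S satisfies that the projection H|_S contains a (d+1)-dimensional pseudo-cube). Then there exists an orientation σ of the one-inclusion graph of H with maximum out-degree at most d. -/

import Mathlib

open Finset
open scoped Classical

/-- A pseudo-cube of dimension `d` over label set `Y`: a nonempty finite set of words such
that every word has, in each coordinate, a neighbor differing exactly in that coordinate. -/
def IsPseudoCube {Y : Type*} {d : ℕ} (H : Set (Fin d → Y)) : Prop :=
  H.Nonempty ∧ H.Finite ∧
    ∀ h ∈ H, ∀ i : Fin d, ∃ g ∈ H, g i ≠ h i ∧ ∀ j, j ≠ i → g j = h j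

/-- An orientation of the one-inclusion graph of `H ⊆ Y^n`: for each direction `i` and each
vertex `h`, a chosen member `σ i h` of the edge in direction `i` through `h`; the choice
depends only on the edge (i.e., on `h` off coordinate `i`). -/
structure OIOrientation {Y : Type*} {n : ℕ} (H : Set (Fin n → Y)) where
  σ : Fin n → (Fin n → Y) → (Fin n → Y)
  mem_of_mem : ∀ (i : Fin n), ∀ h ∈ H, σ i h ∈ H
  agree : ∀ (i : Fin n), ∀ h ∈ H, ∀ j, j ≠ i → σ i h j = h j
  consistent : ∀ (i : Fin n), ∀ g ∈ H, ∀ h ∈ H, (∀ j, j ≠ i → g j = h j) → σ i g = σ i h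

/-- The out-degree of a vertex `v`: the number of edges containing `v` not oriented toward `v`. -/
noncomputable def outdeg {Y : Type*} {n : ℕ} {H : Set (Fin n → Y)}
    (o : OIOrientation H) (v : Fin n → Y) : ℕ :=
  (Finset.univ.filter (fun i : Fin n => o.σ i v ≠ v)).card

/-- The projection of a class `H ⊆ Y^X` to a sequence `S` of points. -/
def proj {X Y : Type*} (H : Set (X → Y)) {k : ℕ} (S : Fin k → X) : Set (Fin k → Y) :=
  {w | ∃ h ∈ H, ∀ j, h (S j) = w j}

/-- `H` DS-shatters the sequence `S` if the projection `H|_S` contains a pseudo-cube. -/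
def DSShatters {X Y : Type*} (H : Set (X → Y)) {k : ℕ} (S : Fin k → X) : Prop :=
  ∃ B ⊆ proj H S, IsPseudoCube B

/-- Rank-nullity for the restriction of a linear map to a subspace. -/
theorem finrank_map_add_finrank_inf_ker {K M N : Type*} [Field K] [AddCommGroup M] [Module K M]
    [AddCommGroup N] [Module K N] (f : M →ₗ[K] N) (U : Submodule K M) [FiniteDimensional K U] :
    Module.finrank K (U.map f) + Module.finrank K ↥(U ⊓ LinearMap.ker f)
      = Module.finrank K U := by
  have h := LinearMap.finrank_range_add_finrank_ker (f.domRestrict U)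
  rw [LinearMap.range_domRestrict, LinearMap.ker_domRestrict] at h
  rw [← h, ← Submodule.map_comap_subtype]
  congr 1
  exact (Submodule.equivMapOfInjective U.subtype U.injective_subtype _).finrank_eq.symm

/-- If the commuting operators `E i` satisfy `(∏_{i ∈ I \ S} E i) V ∩ ⋂_{i ∈ S} ker (E i) = 0`
for all `S ⊆ I` with at least `d` elements, then the dimensions of `V` and of the kernels of
the `E i` on `V` add up to at most `d * dim V`. -/
theorem sum_finrank_inf_ker_add_finrank_le {ι K M : Type*} [DecidableEq ι] [Field K]
    [AddCommGroup M] [Module K M] (E : ι → Module.End K M) (hcomm : Pairwise (Function.onFun Commute E))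
    (I : Finset ι) (d : ℕ) (V : Submodule K M) [FiniteDimensional K V]
    (hV : ∀ S ⊆ I, d ≤ S.card → ∀ x ∈ V,
      (∀ i ∈ S, E i ((I \ S).noncommProd E (hcomm.set_pairwise _) x) = 0) →
        (I \ S).noncommProd E (hcomm.set_pairwise _) x = 0) :
    ∑ i ∈ I, Module.finrank K ↥(V ⊓ LinearMap.ker (E i)) + Module.finrank K V
      ≤ d * Module.finrank K V := by
  induction I using Finset.induction_on generalizing d V with
  | empty =>
    rcases Nat.eq_zero_or_pos d with rfl | hd
    · have : V = ⊥ := (Submodule.eq_bot_iff _).2 fun x hx => by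
        exact hV ∅ (by simp) (by simp) x hx (by simp)
      subst this
      simp
    · simpa using Nat.le_mul_of_pos_left _ hd
  | insert a I ha ih =>
    have h1 := ih d (V.map (E a)) (by
      rintro S hS hd x ⟨v, hv, rfl⟩ hx
      have haS : a ∉ S := fun h => ha (hS h)
      have key := hV S (hS.trans (Finset.subset_insert _ _)) hd v hv
      have hprod : (insert a I \ S).noncommProd E (hcomm.set_pairwise _)
          = (I \ S).noncommProd E (hcomm.set_pairwise _) * E a := by
        rw [← Finset.noncommProd_insert_of_notMem' _ _ _ (hcomm.set_pairwise _) (by simp [ha])]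
        exact Finset.noncommProd_congr (Finset.insert_sdiff_of_notMem _ haS)
          (fun _ _ => rfl) _
      rw [hprod] at key
      exact key hx)
    have h2 := ih (d - 1) (V ⊓ LinearMap.ker (E a)) (by
      rintro S hS hd x ⟨hxV, hxa⟩ hx
      have haS : a ∉ S := fun h => ha (hS h)
      have hsd : insert a I \ insert a S = I \ S := by
        ext j
        simp only [Finset.mem_sdiff, Finset.mem_insert]
        grind
      have key := hV (insert a S) (Finset.insert_subset_insert _ hS)
        (by rw [Finset.card_insert_of_notMem haS]; omega) x hxV
      rw [Finset.noncommProd_congr hsd (fun _ _ => rfl) (hcomm.set_pairwise _)] at key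
      refine key fun i hi => ?_
      rcases Finset.mem_insert.1 hi with rfl | hi
      · have hc : Commute (E i) ((I \ S).noncommProd E (hcomm.set_pairwise _)) :=
          Finset.noncommProd_commute _ _ _ _ fun j hj =>
            hcomm (ne_of_mem_of_not_mem (Finset.mem_sdiff.1 hj).1 ha).symm
        rw [← Module.End.mul_apply, hc.eq, Module.End.mul_apply, LinearMap.mem_ker.1 hxa,
          map_zero]
      · exact hx i hi)
    have h3 : ∑ i ∈ I, Module.finrank K ↥(V ⊓ LinearMap.ker (E i))
        ≤ ∑ i ∈ I, Module.finrank K ↥(V.map (E a) ⊓ LinearMap.ker (E i))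
          + ∑ i ∈ I, Module.finrank K ↥(V ⊓ LinearMap.ker (E a) ⊓ LinearMap.ker (E i)) := by
      rw [← Finset.sum_add_distrib]
      refine Finset.sum_le_sum fun i hi => ?_
      rw [← finrank_map_add_finrank_inf_ker (E a) (V ⊓ LinearMap.ker (E i)), inf_right_comm]
      refine Nat.add_le_add_right (Submodule.finrank_mono ?_) _
      rintro _ ⟨v, ⟨hv, hvi⟩, rfl⟩
      refine ⟨⟨v, hv, rfl⟩, LinearMap.mem_ker.2 ?_⟩
      rw [← Module.End.mul_apply, (hcomm (ne_of_mem_of_not_mem hi ha)).eq, Module.End.mul_apply,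
        LinearMap.mem_ker.1 hvi, map_zero]
    rw [Finset.sum_insert ha, ← finrank_map_add_finrank_inf_ker (E a) V]
    rcases d with _ | d
    · simp only [zero_tsub, zero_mul] at h1 h2 ⊢
      omega
    · simp only [Nat.add_sub_cancel] at h2
      nlinarith

/-- If a nonempty finite set `B` of words that agree on the sequence `s` with
members of `H` has, in every direction of `s`, a neighbor of each of its members, then `H`
DS-shatters `s`. -/
theorem DSShatters.of_neighbors {X Y : Type*} {H : Set (X → Y)} {k : ℕ} {s : Fin k → X}
    (hs : Function.Injective s) {B : Set (X → Y)} (hne : B.Nonempty) (hfin : B.Finite)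
    (hB : ∀ h ∈ B, ∃ a ∈ H, ∀ j, a (s j) = h (s j))
    (hnb : ∀ h ∈ B, ∀ j, ∃ g ∈ B, g ≠ h ∧ ∀ x, x ≠ s j → g x = h x) :
    DSShatters H s := by
  obtain ⟨h₀, hh₀⟩ := hne
  refine ⟨(fun h => h ∘ s) '' {h ∈ B | ∀ x, x ∉ Set.range s → h x = h₀ x}, ?_, ?_, ?_, ?_⟩
  · rintro _ ⟨h, ⟨hh, -⟩, rfl⟩
    exact hB h hh
  · exact ⟨_, h₀, ⟨hh₀, fun _ _ => rfl⟩, rfl⟩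
  · exact (hfin.subset fun h hh => hh.1).image _
  · rintro _ ⟨h, ⟨hh, hx⟩, rfl⟩ j
    obtain ⟨g, hg, hgh, hgx⟩ := hnb h hh j
    refine ⟨_, ⟨g, ⟨hg, fun x hxs => ?_⟩, rfl⟩, fun heq => hgh (funext fun x => ?_),
      fun i hi => hgx _ (hs.ne hi)⟩
    · rw [hgx x (fun h => hxs ⟨j, h.symm⟩), hx x hxs]
    · by_cases hxj : x = s j
      · rw [hxj]; exact heq
      · exact hgx x hxj

/-- The operator on formal combinations of words that overwrites coordinate `i` with `y i`. -/
noncomputable def overwrite {ι Y : Type*} [DecidableEq ι] (y : ι → Y) (i : ι) :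
    Module.End ℚ ((ι → Y) →₀ ℚ) :=
  Finsupp.lmapDomain ℚ ℚ (fun h => Function.update h i (y i))

theorem overwrite_single {ι Y : Type*} [DecidableEq ι] (y : ι → Y) (i : ι) (h : ι → Y) (r : ℚ) :
    overwrite y i (Finsupp.single h r) = Finsupp.single (Function.update h i (y i)) r := by
  simp [overwrite, Finsupp.mapDomain_single]

theorem overwrite_commute {ι Y : Type*} [DecidableEq ι] (y : ι → Y) :
    Pairwise (Function.onFun Commute (overwrite y)) := by
  refine fun i j hij => Finsupp.lhom_ext fun h r => ?_
  simp only [Module.End.mul_apply, overwrite_single]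
  rw [Function.update_comm hij]

/-- Overwriting the coordinates in `T` does not change the restrictions to the complement of `T`
of the words in the support. -/
theorem exists_eqOn_of_mem_support_noncommProd {ι Y : Type*} [DecidableEq ι] (y : ι → Y)
    (A : Set (ι → Y)) (T : Finset ι) {x : (ι → Y) →₀ ℚ} (hx : x ∈ Finsupp.supported ℚ ℚ A)
    {h : ι → Y}
    (hh : h ∈ (T.noncommProd (overwrite y) ((overwrite_commute y).set_pairwise _) x).support) :
    ∃ a ∈ A, ∀ i ∉ T, a i = h i := by
  induction T using Finset.induction_on generalizing h with
  | empty => exact ⟨h, hx (by simpa using hh), fun _ _ => rfl⟩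
  | insert t T ht ih =>
    rw [Finset.noncommProd_insert_of_notMem _ _ _ _ ht, Module.End.mul_apply] at hh
    obtain ⟨g, hg, rfl⟩ := Finset.mem_image.1 (Finsupp.mapDomain_support hh)
    obtain ⟨a, ha, hag⟩ := ih hg
    refine ⟨a, ha, fun i hi => ?_⟩
    rw [Finset.mem_insert, not_or] at hi
    rw [hag i hi.2, Function.update_of_ne hi.1]

/-- A word in the support of an element of `ker (overwrite y i)` has a neighbor in direction `i`
in that support. -/
theorem exists_neighbor_of_overwrite_eq_zero {ι Y : Type*} [DecidableEq ι] (y : ι → Y) (i : ι)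
    {x : (ι → Y) →₀ ℚ} (hx : overwrite y i x = 0) {h : ι → Y} (hh : h ∈ x.support) :
    ∃ g ∈ x.support, g ≠ h ∧ ∀ j, j ≠ i → g j = h j := by
  by_contra! hcon
  have hval : overwrite y i x (Function.update h i (y i)) = x h := by
    rw [overwrite, Finsupp.lmapDomain_apply, Finsupp.mapDomain, Finsupp.sum_apply,
      Finsupp.sum, Finset.sum_eq_single h]
    · simp
    · intro g hg hgh
      obtain ⟨j, hj, hne⟩ := hcon g hg hgh
      refine Finsupp.single_eq_of_ne fun heq => hne ?_
      simpa [Function.update_of_ne hj] using (congrFun heq j).symm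
    · intro hnot
      exact absurd hh hnot
  rw [hx] at hval
  exact Finsupp.mem_support_iff.1 hh hval.symm

/-- In a class of DS dimension at most `d`, every finite subclass `A` meets at least
`(n - d) * |A|` edges of the one-inclusion graph. -/
theorem mul_card_le_sum_card_image_update {Y : Type*} {n d : ℕ} {H : Set (Fin n → Y)}
    (hDS : ∀ S : Fin (d + 1) → Fin n, ¬ DSShatters H S) (y : Fin n → Y)
    (A : Finset (Fin n → Y)) (hA : ↑A ⊆ H) :
    (n - d) * A.card ≤
      ∑ i : Fin n, (A.image fun h => Function.update h i (y i)).card := by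
  have finrank_supported : ∀ s : Finset (Fin n → Y),
      Module.finrank ℚ (Finsupp.supported ℚ ℚ (s : Set (Fin n → Y))) = s.card := by
    intro s
    rw [(Finsupp.supportedEquivFinsupp (s : Set (Fin n → Y))).finrank_eq]
    simp
  have finite_supported : ∀ s : Finset (Fin n → Y),
      FiniteDimensional ℚ (Finsupp.supported ℚ ℚ (s : Set (Fin n → Y))) := fun s =>
    Module.Finite.equiv (Finsupp.supportedEquivFinsupp (M := ℚ) (R := ℚ)
      (s : Set (Fin n → Y))).symm
  have hfd := finite_supported A
  have hrank := sum_finrank_inf_ker_add_finrank_le (overwrite y) (overwrite_commute y)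
    Finset.univ (d + 1) (Finsupp.supported ℚ ℚ (A : Set (Fin n → Y))) (by
      intro S _ hS x hx hker
      by_contra hne
      obtain ⟨T, hTS, hT⟩ := Finset.exists_subset_card_eq hS
      refine hDS (T.orderEmbOfFin hT) (DSShatters.of_neighbors (T.orderEmbOfFin hT).injective
        (Finsupp.support_nonempty_iff.2 hne) (Finset.finite_toSet _) (fun h hh => ?_)
        fun h hh j => exists_neighbor_of_overwrite_eq_zero y _
          (hker _ (hTS (Finset.orderEmbOfFin_mem _ _ _))) hh)
      obtain ⟨a, ha, hah⟩ := exists_eqOn_of_mem_support_noncommProd y _ _ hx hh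
      exact ⟨a, hA ha, fun j => hah _ (by
        simpa using hTS (Finset.orderEmbOfFin_mem T hT j))⟩)
  have hdir : ∀ i : Fin n, A.card ≤ (A.image fun h => Function.update h i (y i)).card
      + Module.finrank ℚ ↥(Finsupp.supported ℚ ℚ (A : Set (Fin n → Y)) ⊓
        LinearMap.ker (overwrite y i)) := by
    intro i
    have h := finrank_map_add_finrank_inf_ker (overwrite y i)
      (Finsupp.supported ℚ ℚ (A : Set (Fin n → Y)))
    rw [finrank_supported] at h
    rw [← h]
    refine Nat.add_le_add_right ?_ _
    have := finite_supported (A.image fun h => Function.update h i (y i))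
    rw [← finrank_supported]
    refine Submodule.finrank_mono (le_of_eq ?_)
    rw [Finset.coe_image]
    exact Finsupp.lmapDomain_supported ℚ ℚ _ _
  rw [finrank_supported] at hrank
  have hsum := Finset.sum_le_sum fun i (_ : i ∈ Finset.univ) => hdir i
  rw [Finset.sum_add_distrib] at hsum
  simp only [Finset.sum_const, Finset.card_univ, Fintype.card_fin, smul_eq_mul] at hsum
  rw [Nat.sub_mul, Nat.sub_le_iff_le_add]
  linarith

/-- A finite class `H ⊆ Y^n` with DS dimension at most `d` (no sequence of
`d+1` coordinates is DS-shattered) admits an orientation of its one-inclusion graph with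
maximum out-degree at most `d`. -/
theorem exists_orientation_of_DS_dim_le {Y : Type*} {n d : ℕ} (H : Set (Fin n → Y))
    (hfin : H.Finite)
    (hDS : ∀ S : Fin (d + 1) → Fin n, ¬ DSShatters H S) :
    ∃ o : OIOrientation H, ∀ v ∈ H, outdeg o v ≤ d := by
  obtain rfl | ⟨y, -⟩ := H.eq_empty_or_nonempty
  · exact ⟨⟨fun _ h => h, by simp, by simp, by simp⟩, by simp⟩
  let key : Fin n → (Fin n → Y) → Fin n × (Fin n → Y) :=
    fun i h => (i, Function.update h i (y i))
  have key_eq : ∀ {i : Fin n} {g h : Fin n → Y},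
      key i g = key i h ↔ ∀ j, j ≠ i → g j = h j := by
    intro i g h
    refine ⟨fun heq j hj => ?_, fun heq => Prod.ext rfl (funext fun j => ?_)⟩
    · simpa [key, Function.update_of_ne hj] using congrFun (congrArg Prod.snd heq) j
    · by_cases hj : j = i
      · subst hj; simp [key]
      · simp [key, Function.update_of_ne hj, heq j hj]
  obtain ⟨f, hf, hft⟩ := (Finset.all_card_le_biUnion_card_iff_exists_injective
    (fun p : H × Fin (n - d) => Finset.univ.image fun i => key i p.1)).1 (by
      intro s
      let A : Finset (Fin n → Y) := s.image fun p => (p.1 : Fin n → Y)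
      have hAH : (A : Set (Fin n → Y)) ⊆ H := by
        intro h hh
        obtain ⟨p, -, rfl⟩ := Finset.mem_image.1 hh
        exact p.1.2
      have hs : s.card ≤ (n - d) * A.card := by
        refine Finset.card_le_mul_card_image s (n - d) fun a _ => ?_
        calc _ ≤ (Finset.univ : Finset (Fin (n - d))).card :=
              Finset.card_le_card_of_injOn Prod.snd (by simp) (by
                intro p hp q hq hpq
                have hp' := (Finset.mem_filter.1 hp).2
                have hq' := (Finset.mem_filter.1 hq).2
                exact Prod.ext (Subtype.ext (hp'.trans hq'.symm)) hpq)
          _ = n - d := by simp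
      refine (hs.trans (mul_card_le_sum_card_image_update hDS y A hAH)).trans ?_
      rw [← Finset.card_sigma]
      refine Finset.card_le_card_of_injOn (fun e => (e.1, e.2)) ?_ ?_
      · rintro ⟨i, w⟩ hw
        obtain ⟨h, hh, hw'⟩ := Finset.mem_image.1 (Finset.mem_sigma.1 hw).2
        change Function.update h i (y i) = w at hw'
        subst hw'
        obtain ⟨p, hp, rfl⟩ := Finset.mem_image.1 hh
        exact Finset.mem_biUnion.2 ⟨p, hp, Finset.mem_image.2 ⟨i, Finset.mem_univ _, rfl⟩⟩
      · rintro ⟨i, w⟩ _ ⟨j, v⟩ _ heq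
        simpa [Sigma.ext_iff] using heq)
  have hchoice : ∀ e : Fin n × (Fin n → Y), ∃ v : Fin n → Y,
      (∀ p, f p = e → v = p.1) ∧ ((∃ h ∈ H, key e.1 h = e) → v ∈ H ∧ key e.1 v = e) := by
    intro e
    by_cases he : ∃ p, f p = e
    · obtain ⟨p, rfl⟩ := he
      refine ⟨p.1, fun q hq => by rw [hf hq], fun _ => ⟨p.1.2, ?_⟩⟩
      obtain ⟨i, -, hi⟩ := Finset.mem_image.1 (hft p)
      rw [← hi]
    · by_cases hE : ∃ h ∈ H, key e.1 h = e
      · obtain ⟨h, hh⟩ := hE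
        exact ⟨h, fun p hp => absurd ⟨p, hp⟩ he, fun _ => hh⟩
      · exact ⟨y, fun p hp => absurd ⟨p, hp⟩ he, fun h => absurd h hE⟩
  choose c hcf hcH using hchoice
  refine ⟨⟨fun i h => c (key i h), fun i h hh => (hcH (key i h) ⟨h, hh, rfl⟩).1,
    fun i h hh => key_eq.1 (hcH (key i h) ⟨h, hh, rfl⟩).2,
    fun i g _ h _ hgh => by rw [key_eq.2 hgh]⟩, fun v hv => ?_⟩
  have hkey : ∀ k, key (f (⟨v, hv⟩, k)).1 v = f (⟨v, hv⟩, k) := by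
    intro k
    obtain ⟨i, -, hi⟩ := Finset.mem_image.1 (hft (⟨v, hv⟩, k))
    rw [← hi]
  have hinj : Function.Injective fun k : Fin (n - d) => (f (⟨v, hv⟩, k)).1 := by
    intro k l hkl
    have hkl' : f (⟨v, hv⟩, k) = f (⟨v, hv⟩, l) := by
      rw [← hkey k, ← hkey l]
      exact congrArg (key · v) hkl
    exact (Prod.mk.inj (hf hkl')).2
  have hsub : Finset.univ.filter (fun i : Fin n => c (key i v) ≠ v)
      ⊆ (Finset.univ.image fun k : Fin (n - d) => (f (⟨v, hv⟩, k)).1)ᶜ := by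
    intro i hi
    rw [Finset.mem_compl, Finset.mem_image]
    rintro ⟨k, -, rfl⟩
    refine (Finset.mem_filter.1 hi).2 ?_
    rw [hkey k]
    exact hcf _ _ rfl
  have hcard := Finset.card_le_card hsub
  rw [Finset.card_compl, Finset.card_image_of_injective _ hinj, Finset.card_univ,
    Fintype.card_fin, Fintype.card_fin] at hcard
  refine le_trans ?_ (show n - (n - d) ≤ d by omega)
  exact hcard
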